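/- Let A, X ∈ ℂ^{m×n}, W ∈ ℂ^{n×m}, and k = ind(A,W). Then X is a {1',2',3',1^{k}'}-inverse of A if and only if XWAWX = X, rank(WAW) = rank(A), the null space of X equals the null space of (WA)*, and the column space of X contains the column space of (AW)^k. The same equivalence holds with the condition XWAWX = X replaced by AWXWA = A. -/

import Mathlib

open Matrix

/-- The index of a square complex matrix: the smallest nonnegative integer `k` with
`rank (M ^ k) = rank (M ^ (k + 1))`. -/
noncomputable def matIndex {p : ℕ} (M : Matrix (Fin p) (Fin p) ℂ) : ℕ :=
  sInf {k : ℕ | (M ^ k).rank = (M ^ (k + 1)).rank}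

/-- The weighted index `ind(A, W) = max (ind (A * W)) (ind (W * A))`. -/
noncomputable def wIndex {m n : ℕ} (A : Matrix (Fin m) (Fin n) ℂ)
    (W : Matrix (Fin n) (Fin m) ℂ) : ℕ :=
  max (matIndex (A * W)) (matIndex (W * A))

/-- Matrices annihilated on the left by `M` are annihilated by any `N` whose kernel is larger. -/
lemma mul_eq_zero_of_ker_le {a b c d : ℕ} {M : Matrix (Fin a) (Fin c) ℂ}
    {N : Matrix (Fin b) (Fin c) ℂ} (h : LinearMap.ker M.mulVecLin ≤ LinearMap.ker N.mulVecLin)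
    {B : Matrix (Fin c) (Fin d) ℂ} (hB : M * B = 0) : N * B = 0 := by
  apply Matrix.ext_of_mulVec_single
  intro i
  have hmem : B *ᵥ Pi.single i 1 ∈ LinearMap.ker M.mulVecLin := by
    simp only [LinearMap.mem_ker, mulVecLin_apply, mulVec_mulVec, hB, zero_mulVec]
  have := h hmem
  simpa only [LinearMap.mem_ker, mulVecLin_apply, mulVec_mulVec, zero_mulVec] using this

lemma rank_add_finrank_ker {a b : ℕ} (M : Matrix (Fin a) (Fin b) ℂ) :
    M.rank + Module.finrank ℂ (LinearMap.ker M.mulVecLin) = b := by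
  simpa [Matrix.rank] using LinearMap.finrank_range_add_finrank_ker M.mulVecLin

lemma rank_eq_of_ker_eq {a b c : ℕ} {M : Matrix (Fin a) (Fin c) ℂ} {N : Matrix (Fin b) (Fin c) ℂ}
    (h : LinearMap.ker M.mulVecLin = LinearMap.ker N.mulVecLin) : M.rank = N.rank := by
  have hM := rank_add_finrank_ker M
  have hN := rank_add_finrank_ker N
  rw [h] at hM
  omega

/-- Left multiplication by `N` does not enlarge the kernel of `M` when it preserves its rank. -/
lemma ker_mul_le_of_rank_le {a b c : ℕ} {M : Matrix (Fin b) (Fin c) ℂ}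
    {N : Matrix (Fin a) (Fin b) ℂ} (h : M.rank ≤ (N * M).rank) :
    LinearMap.ker (N * M).mulVecLin ≤ LinearMap.ker M.mulVecLin := by
  have hle : LinearMap.ker M.mulVecLin ≤ LinearMap.ker (N * M).mulVecLin := by
    rw [mulVecLin_mul]
    exact LinearMap.ker_le_ker_comp _ _
  refine (Submodule.eq_of_le_of_finrank_le hle ?_).ge
  have hM := rank_add_finrank_ker M
  have hN := rank_add_finrank_ker (N * M)
  omega

lemma exists_mul_eq_of_range_le {a b c : ℕ} {M : Matrix (Fin a) (Fin b) ℂ}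
    {N : Matrix (Fin a) (Fin c) ℂ}
    (h : LinearMap.range M.mulVecLin ≤ LinearMap.range N.mulVecLin) :
    ∃ Z : Matrix (Fin c) (Fin b) ℂ, N * Z = M := by
  have hcol (i : Fin b) : ∃ z, N *ᵥ z = M.col i := by
    obtain ⟨z, hz⟩ := h ⟨Pi.single i 1, rfl⟩
    exact ⟨z, by simpa using hz⟩
  choose z hz using hcol
  refine ⟨(Matrix.of z)ᵀ, ?_⟩
  ext i j
  exact congrFun (hz j) i

section WeightedInverse

variable {m n : ℕ} {A X : Matrix (Fin m) (Fin n) ℂ} {W : Matrix (Fin n) (Fin m) ℂ}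

lemma rank_weighted_eq (h : A * W * X * W * A = A) : (W * A * W).rank = A.rank := by
  apply le_antisymm
  · rw [Matrix.mul_assoc]
    exact (rank_mul_le_right _ _).trans (rank_mul_le_left _ _)
  · have hA : A * W * X * ((W * A * W) * (X * W * A)) = A := by
      calc _ = A * W * X * W * (A * W * X * W * A) := by simp only [Matrix.mul_assoc]
        _ = A := by rw [h, h]
    calc A.rank = (A * W * X * ((W * A * W) * (X * W * A))).rank := by rw [hA]
      _ ≤ ((W * A * W) * (X * W * A)).rank := rank_mul_le_right _ _
      _ ≤ (W * A * W).rank := rank_mul_le_left _ _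

lemma ker_eq_ker_conjTranspose (h₁ : A * W * X * W * A = A) (h₂ : X * W * A * W * X = X)
    (h₃ : (W * A * W * X)ᴴ = W * A * W * X) :
    LinearMap.ker X.mulVecLin = LinearMap.ker ((W * A)ᴴ).mulVecLin := by
  have hX : X * (W * X)ᴴ * (W * A)ᴴ = X := by
    rw [Matrix.mul_assoc, ← conjTranspose_mul, ← Matrix.mul_assoc, h₃]
    simpa only [Matrix.mul_assoc] using h₂
  have hWA : (W * A)ᴴ * (W * A * W) * X = (W * A)ᴴ := by
    rw [Matrix.mul_assoc, ← h₃, ← conjTranspose_mul]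
    congr 1
    calc _ = W * (A * W * X * W * A) := by simp only [Matrix.mul_assoc]
      _ = W * A := by rw [h₁]
  apply le_antisymm
  · rw [← hWA, mulVecLin_mul]
    exact LinearMap.ker_le_ker_comp _ _
  · rw [← hX]
    rw [mulVecLin_mul]
    exact LinearMap.ker_le_ker_comp _ _

lemma weightedInverse_of_outer {k : ℕ} (h₂ : X * W * A * W * X = X)
    (hr : (W * A * W).rank = A.rank)
    (hker : LinearMap.ker X.mulVecLin = LinearMap.ker ((W * A)ᴴ).mulVecLin)
    (hrange : LinearMap.range ((A * W) ^ k).mulVecLin ≤ LinearMap.range X.mulVecLin) :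
    A * W * X * W * A = A ∧ (W * A * W * X)ᴴ = W * A * W * X ∧
      X * W * (A * W) ^ (k + 1) = (A * W) ^ k := by
  have hX : X * (1 - W * A * W * X) = 0 := by
    rw [Matrix.mul_sub, Matrix.mul_one, sub_eq_zero]
    simpa only [Matrix.mul_assoc] using h₂.symm
  have hWA : (W * A * W * X)ᴴ * (W * A) = W * A := by
    have h := mul_eq_zero_of_ker_le hker.le hX
    rw [Matrix.mul_sub, Matrix.mul_one, sub_eq_zero] at h
    simpa only [conjTranspose_mul, conjTranspose_conjTranspose, Matrix.mul_assoc]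
      using (congrArg conjTranspose h).symm
  have hH : (W * A * W * X)ᴴ * (W * A * W * X) = W * A * W * X := by
    simpa only [Matrix.mul_assoc] using congrArg (· * (W * X)) hWA
  have h₃ : (W * A * W * X)ᴴ = W * A * W * X := by
    rw [← hH, conjTranspose_mul, conjTranspose_conjTranspose]
  refine ⟨?_, h₃, ?_⟩
  · have hrank : A.rank ≤ (W * A).rank := hr ▸ rank_mul_le_left _ _
    have hz : W * A * (W * X * W * A - 1) = 0 := by
      rw [h₃] at hWA
      rw [Matrix.mul_sub, Matrix.mul_one, sub_eq_zero]
      simpa only [Matrix.mul_assoc] using hWA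
    have h := mul_eq_zero_of_ker_le (ker_mul_le_of_rank_le hrank) hz
    rw [Matrix.mul_sub, Matrix.mul_one, sub_eq_zero] at h
    simpa only [Matrix.mul_assoc] using h
  · obtain ⟨Z, hZ⟩ := exists_mul_eq_of_range_le hrange
    rw [pow_succ', ← hZ]
    simpa only [Matrix.mul_assoc] using congrArg (· * Z) h₂

open scoped ComplexOrder in
lemma outer_of_inner (h₁ : A * W * X * W * A = A)
    (hker : LinearMap.ker X.mulVecLin = LinearMap.ker ((W * A)ᴴ).mulVecLin) :
    X * W * A * W * X = X := by
  have hWA : W * A * W * X * (W * A) = W * A := by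
    simpa only [Matrix.mul_assoc] using congrArg (W * ·) h₁
  have hrank : X.rank ≤ (W * A * W * X).rank := by
    calc X.rank = (W * A).rank := by rw [rank_eq_of_ker_eq hker, rank_conjTranspose]
      _ = (W * A * W * X * (W * A)).rank := by rw [hWA]
      _ ≤ _ := rank_mul_le_left _ _
  have hz : W * A * W * X * (W * A * W * X - 1) = 0 := by
    rw [Matrix.mul_sub, Matrix.mul_one, sub_eq_zero]
    simpa only [Matrix.mul_assoc] using congrArg (· * (W * X)) hWA
  have h := mul_eq_zero_of_ker_le (ker_mul_le_of_rank_le hrank) hz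
  rw [Matrix.mul_sub, Matrix.mul_one, sub_eq_zero] at h
  simpa only [Matrix.mul_assoc] using h

lemma range_pow_le {k : ℕ} (h : X * W * (A * W) ^ (k + 1) = (A * W) ^ k) :
    LinearMap.range ((A * W) ^ k).mulVecLin ≤ LinearMap.range X.mulVecLin := by
  rw [← h, Matrix.mul_assoc, mulVecLin_mul]
  exact LinearMap.range_comp_le_range _ _

end WeightedInverse


/-- characterizations of `{1',2',3',1^k'}`-inverses via rank, null space of
`(W*A)*` and containment of the column space of `(A*W)^k`; the outer equation `XWAWX = X`
may be replaced by the inner equation `AWXWA = A`. -/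
theorem stmt15 (m n : ℕ) (A X : Matrix (Fin m) (Fin n) ℂ) (W : Matrix (Fin n) (Fin m) ℂ)
    (k : ℕ) (hk : k = wIndex A W) :
    ((A * W * X * W * A = A ∧
        X * W * A * W * X = X ∧
        (W * A * W * X)ᴴ = W * A * W * X ∧
        X * W * (A * W) ^ (k + 1) = (A * W) ^ k) ↔
      (X * W * A * W * X = X ∧
        (W * A * W).rank = A.rank ∧
        LinearMap.ker X.mulVecLin = LinearMap.ker ((W * A)ᴴ).mulVecLin ∧
        LinearMap.range ((A * W) ^ k).mulVecLin ≤ LinearMap.range X.mulVecLin)) ∧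
    ((A * W * X * W * A = A ∧
        X * W * A * W * X = X ∧
        (W * A * W * X)ᴴ = W * A * W * X ∧
        X * W * (A * W) ^ (k + 1) = (A * W) ^ k) ↔
      (A * W * X * W * A = A ∧
        (W * A * W).rank = A.rank ∧
        LinearMap.ker X.mulVecLin = LinearMap.ker ((W * A)ᴴ).mulVecLin ∧
        LinearMap.range ((A * W) ^ k).mulVecLin ≤ LinearMap.range X.mulVecLin)) := by
  refine ⟨⟨?_, ?_⟩, ⟨?_, ?_⟩⟩
  · rintro ⟨h₁, h₂, h₃, h₄⟩
    exact ⟨h₂, rank_weighted_eq h₁, ker_eq_ker_conjTranspose h₁ h₂ h₃, range_pow_le h₄⟩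
  · rintro ⟨h₂, hr, hker, hrange⟩
    obtain ⟨h₁, h₃, h₄⟩ := weightedInverse_of_outer h₂ hr hker hrange
    exact ⟨h₁, h₂, h₃, h₄⟩
  · rintro ⟨h₁, h₂, h₃, h₄⟩
    exact ⟨h₁, rank_weighted_eq h₁, ker_eq_ker_conjTranspose h₁ h₂ h₃, range_pow_le h₄⟩
  · rintro ⟨h₁, hr, hker, hrange⟩
    have h₂ := outer_of_inner h₁ hker
    obtain ⟨-, h₃, h₄⟩ := weightedInverse_of_outer h₂ hr hker hrange
    exact ⟨h₁, h₂, h₃, h₄⟩
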